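/- arXiv:1508.06937 — 2 statements merged into one kernel-verified Lean document; each statement's English description precedes it below -/
import Mathlib

section
/- Let a8,a9,a10,r ∈ F_q^×. Then ∑_{s1,s2,s4 ∈ F_q} φ(r·(a8·s1·s2 + a9·s1·s4 + a10·s2·s4)) = q·∑_{s ∈ F_q} φ(−a8·a9·a10·r·s^2). -/
open Finset

noncomputable section

/-- The additive character `φ(x) = exp(2πi·Tr(x)/p)` of `F_q`, where `Tr` is the trace to `F_p`. -/
def phi (p : ℕ) (F : Type) [Field F] [Fintype F] [Algebra (ZMod p) F] (x : F) : ℂ :=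
  Complex.exp (2 * Real.pi * Complex.I * ((Algebra.trace (ZMod p) F x).val : ℂ) / (p : ℂ))

/-- `phi` bundled as an additive character. -/
def phiChar (p : ℕ) [Fact p.Prime] (F : Type) [Field F] [Fintype F] [Algebra (ZMod p) F] :
    AddChar F ℂ :=
  (ZMod.stdAddChar (N := p)).compAddMonoidHom (Algebra.trace (ZMod p) F).toAddMonoidHom

theorem phiChar_apply (p : ℕ) [Fact p.Prime] (F : Type) [Field F] [Fintype F]
    [Algebra (ZMod p) F] (x : F) : phiChar p F x = phi p F x := by
  simp [phiChar, phi, ZMod.stdAddChar_apply, ZMod.toCircle_apply]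

theorem phiChar_isPrimitive (p : ℕ) [Fact p.Prime] (F : Type) [Field F] [Fintype F]
    [Algebra (ZMod p) F] : (phiChar p F).IsPrimitive := by
  apply AddChar.IsPrimitive.of_ne_one
  obtain ⟨x, hx⟩ := Algebra.trace_surjective (ZMod p) F 1
  intro h
  have h1 : ZMod.stdAddChar (N := p) 1 = ZMod.stdAddChar (N := p) 0 := by
    simpa [phiChar, hx] using DFunLike.congr_fun h x
  exact one_ne_zero (ZMod.injective_stdAddChar h1)

/-- A primitive character summed over a ternary quadratic form without square terms. -/
theorem AddChar.IsPrimitive.sum_mul_add_mul_add_mul {F : Type*} [Field F] [Fintype F]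
    {ψ : AddChar F ℂ} (hψ : ψ.IsPrimitive) {a b c : F} (hc : c ≠ 0) {r : F}
    (hr : r ≠ 0) :
    ∑ x : F, ∑ y : F, ∑ z : F, ψ (r * (a * x * y + b * x * z + c * y * z)) =
      (Fintype.card F : ℂ) * ∑ s : F, ψ (-(a * b * c * r) * s ^ 2) := by
  classical
  have inner (x y : F) : ∑ z : F, ψ (r * (a * x * y + b * x * z + c * y * z)) =
      if y = -(b * x / c) then ψ (r * a * x * y) * (Fintype.card F : ℂ) else 0 := by
    have hzero : r * (b * x + c * y) = 0 ↔ y = -(b * x / c) := by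
      rw [mul_eq_zero, or_iff_right hr]
      constructor
      · intro h
        field_simp
        linear_combination h
      · rintro rfl
        field_simp
        ring
    have hsplit (z : F) : r * (a * x * y + b * x * z + c * y * z) =
        r * a * x * y + z * (r * (b * x + c * y)) := by ring
    simp_rw [hsplit, AddChar.map_add_eq_mul, ← Finset.mul_sum,
      AddChar.sum_mulShift _ hψ, hzero]
    split_ifs <;> simp
  simp_rw [inner, Finset.sum_ite_eq', Finset.mem_univ, if_true, ← Finset.sum_mul]
  rw [mul_comm, ← Equiv.sum_comp (Equiv.mulLeft₀ c hc)]
  congr 1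
  refine Finset.sum_congr rfl fun s _ => congrArg ψ ?_
  simp only [Equiv.mulLeft₀_apply]
  field_simp


/-- `∑_{s1,s2,s4} φ(r·(a8·s1·s2 + a9·s1·s4 + a10·s2·s4)) = q·∑_s φ(−a8·a9·a10·r·s²)`. -/
theorem stmt10 (p : ℕ) [Fact p.Prime] (F : Type) [Field F] [Fintype F] [CharP F p]
    [Algebra (ZMod p) F] (a8 a9 a10 r : F) (h8 : a8 ≠ 0) (h9 : a9 ≠ 0) (h10 : a10 ≠ 0)
    (hr : r ≠ 0) :
    ∑ s1 : F, ∑ s2 : F, ∑ s4 : F,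
        phi p F (r * (a8 * s1 * s2 + a9 * s1 * s4 + a10 * s2 * s4)) =
      (Fintype.card F : ℂ) * ∑ s : F, phi p F (-(a8 * a9 * a10 * r) * s ^ 2) := by
  simpa only [phiChar_apply] using
    (phiChar_isPrimitive p F).sum_mul_add_mul_add_mul (a := a8) (b := a9) h10 hr
end
end

section
/- Suppose p = 2. Let a8,a9,a10 ∈ F_q^× and define λ on K = {0}×V by λ(t3,t5,t6,t7,t8,t9,t10) = φ(a8·t8 + a9·t9 + a10·t10). Then for every t ∈ F_q^{10}, λ^H(x(t)) = q^3·φ(a8·t8 + a9·t9 + a10·t10) if t1 = t2 = t3 = t4 = 0, a8·t5 + a10·t7 = 0 and a8·t6 + a9·t7 = 0, and λ^H(x(t)) = 0 otherwise. -/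
open Finset
open scoped Classical

noncomputable section

namespace UM11

variable (F : Type) [Field F] [Fintype F]

/- `V = F_q^7` has coordinates `(t3,t5,t6,t7,t8,t9,t10)`, indexed `0,…,6`. -/

/-- `σ1(s) : t5 ↦ t5 − s·t3, t8 ↦ t8 − s·t6, t9 ↦ t9 − s·t7`. -/
def sig1 (s : F) (v : Fin 7 → F) : Fin 7 → F :=
  ![v 0, v 1 - s * v 0, v 2, v 3, v 4 - s * v 2, v 5 - s * v 3, v 6]

/-- `σ2(s) : t6 ↦ t6 − s·t3, t8 ↦ t8 − s·t5, t10 ↦ t10 − s·t7`. -/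
def sig2 (s : F) (v : Fin 7 → F) : Fin 7 → F :=
  ![v 0, v 1, v 2 - s * v 0, v 3, v 4 - s * v 1, v 5, v 6 - s * v 3]

/-- `σ4(s) : t7 ↦ t7 − s·t3, t9 ↦ t9 − s·t5, t10 ↦ t10 − s·t6`. -/
def sig4 (s : F) (v : Fin 7 → F) : Fin 7 → F :=
  ![v 0, v 1, v 2, v 3 - s * v 0, v 4, v 5 - s * v 1, v 6 - s * v 2]

/-- The composite action `σ1(s1)σ2(s2)σ4(s4)` of `F_q^3` on `V`. -/
def sigma (s : Fin 3 → F) (v : Fin 7 → F) : Fin 7 → F :=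
  sig1 F (s 0) (sig2 F (s 1) (sig4 F (s 2) v))

/-- Multiplication in the semidirect product `H = F_q^3 ⋉ V`:
conjugating `(0,v)` by `(s,0)` yields `(0, σ1(s1)σ2(s2)σ4(s4)(v))`. -/
def Hmul (x y : (Fin 3 → F) × (Fin 7 → F)) : (Fin 3 → F) × (Fin 7 → F) :=
  (x.1 + y.1, sigma F y.1 x.2 + y.2)

/-- Inversion in `H`. -/
def Hinv (x : (Fin 3 → F) × (Fin 7 → F)) : (Fin 3 → F) × (Fin 7 → F) :=
  (-x.1, -(sigma F (-x.1) x.2))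

/-- Conjugation `x⁻¹ h x` in `H`. -/
def Hconj (x h : (Fin 3 → F) × (Fin 7 → F)) : (Fin 3 → F) × (Fin 7 → F) :=
  Hmul F (Hmul F (Hinv F x) h) x

/-- The element `x(t) = (0,(t3,0,…,0))·((t1,t2,t4),0)·(0,(0,t5,t6,t7,t8,t9,t10))` of `H`,
for `t = (t1,…,t10)` (indexed `0,…,9`). -/
def xelt (t : Fin 10 → F) : (Fin 3 → F) × (Fin 7 → F) :=
  Hmul F (Hmul F ((0 : Fin 3 → F), ![t 2, 0, 0, 0, 0, 0, 0]) (![t 0, t 1, t 3], (0 : Fin 7 → F)))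
    ((0 : Fin 3 → F), ![0, t 4, t 5, t 6, t 7, t 8, t 9])

/-- The extension by zero `λ̇` to `H` of a function `λ` on `K = {0} × V`. -/
def lamDot (lam : (Fin 7 → F) → ℂ) (h : (Fin 3 → F) × (Fin 7 → F)) : ℂ :=
  if h.1 = 0 then lam h.2 else 0

/-- The induced class function `λ^H(h) = (1/q^7) ∑_{x∈H} λ̇(x⁻¹ h x)`. -/
def ind (lam : (Fin 7 → F) → ℂ) (h : (Fin 3 → F) × (Fin 7 → F)) : ℂ :=
  (1 / (Fintype.card F : ℂ) ^ 7) * ∑ x : (Fin 3 → F) × (Fin 7 → F), lamDot F lam (Hconj F x h)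

end UM11
section Character

variable {p : ℕ} [Fact p.Prime] {F : Type} [Field F] [Fintype F] [Algebra (ZMod p) F]

lemma phi_eq_stdAddChar (x : F) :
    phi p F x = ZMod.stdAddChar (Algebra.trace (ZMod p) F x) := by
  rw [ZMod.stdAddChar_apply, ZMod.toCircle_apply, phi]

lemma phi_add (x y : F) : phi p F (x + y) = phi p F x * phi p F y := by
  simp only [phi_eq_stdAddChar, map_add, AddChar.map_add_eq_mul]

lemma exists_phi_mul_ne_one {a : F} (ha : a ≠ 0) : ∃ x, phi p F (a * x) ≠ 1 := by
  obtain ⟨y, hy⟩ := Algebra.trace_surjective (ZMod p) F 1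
  refine ⟨y / a, fun h => ?_⟩
  rw [mul_div_cancel₀ y ha, phi_eq_stdAddChar, hy,
    ← AddChar.map_zero_eq_one (ZMod.stdAddChar (N := p))] at h
  exact one_ne_zero (ZMod.injective_stdAddChar h)

lemma sum_phi_eq_zero_of_translate {G : Type} [AddGroup G] [Fintype G] (f : G → F) (d : G) {c : F}
    (hf : ∀ s, f (s + d) = f s + c) (hc : phi p F c ≠ 1) : ∑ s, phi p F (f s) = 0 := by
  have h : ∑ s, phi p F (f s) = (∑ s, phi p F (f s)) * phi p F c := by
    rw [Finset.sum_mul, ← Equiv.sum_comp (Equiv.addRight d)]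
    simp [hf, phi_add]
  by_contra h0
  exact hc ((left_eq_mul₀ h0).mp h)

end Character

namespace UM11

variable {F : Type} [Field F]

lemma Hconj_fst (x h : (Fin 3 → F) × (Fin 7 → F)) : (Hconj F x h).1 = h.1 := by
  simp [Hconj, Hmul, Hinv]

lemma Hconj_zero_left (x : (Fin 3 → F) × (Fin 7 → F)) (v : Fin 7 → F) :
    Hconj F x (0, v) = (0, sigma F x.1 v) := by
  ext i
  · simp [Hconj, Hmul, Hinv]
  · fin_cases i <;>
      simp [Hconj, Hmul, Hinv, sigma, sig1, sig2, sig4, Matrix.vecHead, Matrix.vecTail] <;> ring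

lemma xelt_fst (t : Fin 10 → F) : (xelt F t).1 = ![t 0, t 1, t 3] := by
  simp [xelt, Hmul]

lemma xelt_of_eq_zero {t : Fin 10 → F} (h0 : t 0 = 0) (h1 : t 1 = 0) (h3 : t 3 = 0) :
    xelt F t = (0, ![t 2, t 4, t 5, t 6, t 7, t 8, t 9]) := by
  ext i
  · fin_cases i <;> simp [xelt, Hmul, h0, h1, h3]
  · fin_cases i <;> simp [xelt, Hmul, sigma, sig1, sig2, sig4, h0, h1, h3]

variable [Fintype F]

lemma ind_eq_zero (lam : (Fin 7 → F) → ℂ) {h : (Fin 3 → F) × (Fin 7 → F)} (hh : h.1 ≠ 0) :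
    ind F lam h = 0 := by
  simp [ind, lamDot, Hconj_fst, hh]

lemma ind_zero_left (lam : (Fin 7 → F) → ℂ) (v : Fin 7 → F) :
    ind F lam (0, v) = ∑ s, lam (sigma F s v) := by
  have hq : (Fintype.card F : ℂ) ≠ 0 := Nat.cast_ne_zero.mpr Fintype.card_ne_zero
  simp only [ind, lamDot, Hconj_zero_left, if_true, Fintype.sum_prod_type, Finset.sum_const,
    Finset.card_univ, Fintype.card_fun, Fintype.card_fin, nsmul_eq_mul, ← Finset.mul_sum]
  push_cast
  field_simp

end UM11

open UM11 in
/-- for `p = 2`, the induced character `λ^H`, where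
`λ(t3,t5,t6,t7,t8,t9,t10) = φ(a8·t8 + a9·t9 + a10·t10)` on `K = {0}×V`, satisfies
`λ^H(x(t)) = q³·φ(a8·t8 + a9·t9 + a10·t10)` if `t1 = t2 = t3 = t4 = 0`,
`a8·t5 + a10·t7 = 0` and `a8·t6 + a9·t7 = 0`, and `λ^H(x(t)) = 0` otherwise. -/
theorem stmt14 (F : Type) [Field F] [Fintype F] [CharP F 2]
    [Algebra (ZMod 2) F] (a8 a9 a10 : F) (h8 : a8 ≠ 0) (h9 : a9 ≠ 0) (h10 : a10 ≠ 0)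
    (t : Fin 10 → F) :
    ind F (fun v => phi 2 F (a8 * v 4 + a9 * v 5 + a10 * v 6)) (xelt F t) =
    if t 0 = 0 ∧ t 1 = 0 ∧ t 2 = 0 ∧ t 3 = 0 ∧
        a8 * t 4 + a10 * t 6 = 0 ∧ a8 * t 5 + a9 * t 6 = 0 then
      (Fintype.card F : ℂ) ^ 3 * phi 2 F (a8 * t 7 + a9 * t 8 + a10 * t 9)
    else 0 := by
  have : Fact (Nat.Prime 2) := ⟨Nat.prime_two⟩
  have h2 : (2 : F) = 0 := CharTwo.two_eq_zero
  by_cases hK : t 0 = 0 ∧ t 1 = 0 ∧ t 3 = 0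
  swap
  · rw [ind_eq_zero, if_neg (by tauto)]
    rw [xelt_fst]
    intro h
    exact hK ⟨congrFun h 0, congrFun h 1, congrFun h 2⟩
  obtain ⟨h0, h1, h3⟩ := hK
  rw [xelt_of_eq_zero h0 h1 h3, ind_zero_left]
  split_ifs with hc
  · obtain ⟨-, -, ht, -, e1, e2⟩ := hc
    have e3 : a9 * t 4 + a10 * t 5 = 0 := by
      refine (mul_eq_zero.mp ?_).resolve_left h8
      linear_combination a9 * e1 + a10 * e2 - a9 * a10 * t 6 * h2
    rw [Finset.sum_congr rfl (g := fun _ => phi 2 F (a8 * t 7 + a9 * t 8 + a10 * t 9))]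
    · simp
    · intro s _
      congr 1
      simp [sigma, sig1, sig2, sig4, ht]
      linear_combination -s 1 * e1 - s 0 * e2 - s 2 * e3
  by_cases ht : t 2 = 0
  · by_cases e1 : a8 * t 4 + a10 * t 6 = 0
    · have e2 : a8 * t 5 + a9 * t 6 ≠ 0 := fun e2 => hc ⟨h0, h1, ht, h3, e1, e2⟩
      obtain ⟨x, hx⟩ := exists_phi_mul_ne_one (p := 2) e2
      refine sum_phi_eq_zero_of_translate _ ![-x, 0, 0] (fun s => ?_) hx
      simp [sigma, sig1, sig2, sig4, ht]
      ring
    · obtain ⟨x, hx⟩ := exists_phi_mul_ne_one (p := 2) e1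
      refine sum_phi_eq_zero_of_translate _ ![0, -x, 0] (fun s => ?_) hx
      simp [sigma, sig1, sig2, sig4, ht]
      ring
  · have ha : t 2 * a8 * a9 * a10 ≠ 0 := by simp [ht, h8, h9, h10]
    obtain ⟨y, hy⟩ := exists_phi_mul_ne_one (p := 2) ha
    obtain ⟨x, rfl⟩ : ∃ x, x ^ 2 = y := by
      obtain ⟨x, hx⟩ := FiniteField.isSquare_of_char_two (ringChar.eq F 2) y
      exact ⟨x, by rw [hx, sq]⟩
    -- The direction `(a10, a9, a8)` spans the radical of the polar form of the exponent.
    refine sum_phi_eq_zero_of_translate _ ![a10 * x, a9 * x, a8 * x] (fun s => ?_) hy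
    simp [sigma, sig1, sig2, sig4]
    linear_combination (t 2 * a8 * a9 * a10 * x ^ 2
      + t 2 * x * (a8 * a9 * s 0 + a8 * a10 * s 1 + a9 * a10 * s 2)
      - x * (a8 * a9 * t 4 + a8 * a10 * t 5 + a9 * a10 * t 6)) * h2
end
end
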